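/- If a language L over a finite alphabet Σ is accepted by a Boolean finite automaton with n states, then the Kleene star L* is accepted by an alternating finite automaton with 2^n states. -/

import Mathlib

/-- A Boolean finite automaton (BFA): `δ` maps each state and symbol to a
Boolean function in the state variables, `g` is the initial Boolean function,
and `accept` is the finality (characteristic) vector of the final state set. -/
structure BFA (α : Type) (σ : Type) where
  δ : σ → α → (σ → Bool) → Bool
  g : (σ → Bool) → Bool
  accept : σ → Bool

namespace BFA

variable {α σ : Type}

/-- One-symbol action on Boolean functions: `(h·a)(v) = h (fun q => δ q a v)`. -/
def stepFn (A : BFA α σ) (h : (σ → Bool) → Bool) (a : α) : (σ → Bool) → Bool :=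
  fun v => h fun q => A.δ q a v

/-- Action of a string on the initial function: `g·ε = g`, `g·(wa) = (g·w)·a`. -/
def eval (A : BFA α σ) (w : List α) : (σ → Bool) → Bool :=
  w.foldl A.stepFn A.g

/-- The language of a BFA: strings whose resulting Boolean function
evaluates to `true` on the finality vector. -/
def language (A : BFA α σ) : Language α :=
  { w | A.eval w A.accept = true }

/-- A BFA is alternating (an AFA) if its initial function is a projection. -/
def IsAFA (A : BFA α σ) : Prop :=
  ∃ q₀ : σ, A.g = fun v => v q₀

end BFA

/-- `L` is accepted by some `n`-state BFA. -/
def AcceptsBFA {α : Type} (L : Language α) (n : ℕ) : Prop :=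
  ∃ (σ : Type) (_ : Fintype σ), Fintype.card σ = n ∧ ∃ A : BFA α σ, A.language = L

/-- `L` is accepted by some `n`-state AFA. -/
def AcceptsAFA {α : Type} (L : Language α) (n : ℕ) : Prop :=
  ∃ (σ : Type) (_ : Fintype σ), Fintype.card σ = n ∧
    ∃ A : BFA α σ, A.IsAFA ∧ A.language = L

/-- `L` is accepted by some `n`-state DFA. -/
def AcceptsDFA {α : Type} (L : Language α) (n : ℕ) : Prop :=
  ∃ (σ : Type) (_ : Fintype σ), Fintype.card σ = n ∧ ∃ D : DFA α σ, D.accepts = L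

/-- `L` is accepted by some `n`-state NFA with a unique initial state. -/
def AcceptsNFA1 {α : Type} (L : Language α) (n : ℕ) : Prop :=
  ∃ (σ : Type) (_ : Fintype σ), Fintype.card σ = n ∧
    ∃ (M : NFA α σ) (q₀ : σ), M.start = {q₀} ∧ M.accepts = L

/-- The reversal of a language. -/
def Language.rev {α : Type} (L : Language α) : Language α :=
  { w | w.reverse ∈ L }

namespace BFA

variable {α σ : Type}

/-- The state vector obtained by reading a word from right to left. -/
def vec (A : BFA α σ) (w : List α) : σ → Bool :=
  w.foldr (fun a v q => A.δ q a v) A.accept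

theorem foldl_stepFn (A : BFA α σ) (w : List α) (h : (σ → Bool) → Bool) (v : σ → Bool) :
    w.foldl A.stepFn h v = h (w.foldr (fun a v q => A.δ q a v) v) := by
  induction w generalizing h with
  | nil => rfl
  | cons a w ih => rw [List.foldl_cons, ih]; rfl

theorem mem_language (A : BFA α σ) (w : List α) :
    w ∈ A.language ↔ A.g (A.vec w) = true := by
  change w.foldl A.stepFn A.g A.accept = true ↔ _
  rw [foldl_stepFn]
  rfl

theorem vec_cons (A : BFA α σ) (a : α) (w : List α) :
    A.vec (a :: w) = fun q => A.δ q a (A.vec w) := rfl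

end BFA

theorem Language.cons_mem_kstar {α : Type} (L : Language α) (a : α) (w : List α) :
    a :: w ∈ KStar.kstar L ↔
      ∃ u v, w = u ++ v ∧ v ∈ KStar.kstar L ∧ a :: u ∈ L := by
  constructor
  · intro h
    rw [Language.kstar_def_nonempty] at h
    obtain ⟨S, hw, hS⟩ := h
    match S with
    | [] => simp at hw
    | [] :: S => exact absurd rfl (hS [] (by simp)).2
    | (b :: u) :: S =>
      simp only [List.flatten_cons, List.cons_append, List.cons.injEq] at hw
      obtain ⟨rfl, rfl⟩ := hw
      refine ⟨u, S.flatten, rfl, ?_, (hS _ (by simp)).1⟩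
      exact Language.join_mem_kstar fun y hy => (hS y (by simp [hy])).1
  · rintro ⟨u, v, rfl, hv, hu⟩
    rw [← Language.one_add_self_mul_kstar_eq_kstar]
    exact Or.inr ⟨a :: u, hu, v, hv, rfl⟩

namespace BFA

variable {α σ : Type}

/-- The vectors obtained by reading a prefix of `w` whose complementary suffix is in `L∗`. -/
def starVecs (A : BFA α σ) (w : List α) : Set (σ → Bool) :=
  { p | ∃ u v, w = u ++ v ∧ v ∈ KStar.kstar A.language ∧ A.vec u = p }

/-- One step of the subset construction for the reversal of `L∗`. -/
def starStep (A : BFA α σ) (a : α) (X : Set (σ → Bool)) : Set (σ → Bool) :=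
  { p | (∃ r ∈ X, (fun q => A.δ q a r) = p) ∨
    ((∃ r ∈ X, A.g (fun q => A.δ q a r) = true) ∧ p = A.accept) }

theorem starVecs_nil (A : BFA α σ) : A.starVecs [] = {A.accept} := by
  ext p
  constructor
  · rintro ⟨u, v, h, -, rfl⟩
    obtain ⟨rfl, rfl⟩ := List.append_eq_nil_iff.mp h.symm
    rfl
  · rintro rfl
    exact ⟨[], [], rfl, Language.nil_mem_kstar _, rfl⟩

theorem cons_mem_kstar_language (A : BFA α σ) (a : α) (w : List α) :
    a :: w ∈ KStar.kstar A.language ↔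
      ∃ r ∈ A.starVecs w, A.g (fun q => A.δ q a r) = true := by
  rw [Language.cons_mem_kstar]
  constructor
  · rintro ⟨u, v, hw, hv, hu⟩
    exact ⟨_, ⟨u, v, hw, hv, rfl⟩, (A.mem_language _).mp hu⟩
  · rintro ⟨_, ⟨u, v, hw, hv, rfl⟩, hu⟩
    exact ⟨u, v, hw, hv, (A.mem_language _).mpr hu⟩

theorem starVecs_cons (A : BFA α σ) (a : α) (w : List α) :
    A.starVecs (a :: w) = A.starStep a (A.starVecs w) := by
  ext p
  constructor
  · rintro ⟨u, v, h, hv, rfl⟩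
    cases u with
    | nil =>
      obtain rfl : a :: w = v := h
      exact Or.inr ⟨(A.cons_mem_kstar_language a w).mp hv, rfl⟩
    | cons b u =>
      obtain ⟨rfl, rfl⟩ := List.cons.inj h
      exact Or.inl ⟨_, ⟨u, v, rfl, hv, rfl⟩, rfl⟩
  · rintro (⟨_, ⟨u, v, rfl, hv, rfl⟩, rfl⟩ | ⟨h, rfl⟩)
    · exact ⟨a :: u, v, rfl, hv, rfl⟩
    · exact ⟨[], a :: w, rfl, (A.cons_mem_kstar_language a w).mpr h, rfl⟩

open Classical in
/-- Encode a set of vectors so that the coordinate at `A.accept` records whether the set contains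
a vector satisfying the initial function; `f` is some such vector. -/
noncomputable def starEnc (A : BFA α σ) (f : σ → Bool) (X : Set (σ → Bool)) :
    (σ → Bool) → Bool :=
  fun q => if ∃ r ∈ X, A.g r = true then decide (q ∈ X)
    else decide (Equiv.swap A.accept f q ∈ X)

open Classical in
/-- The left inverse of `starEnc`. -/
noncomputable def starDec (A : BFA α σ) (f : σ → Bool) (V : (σ → Bool) → Bool) :
    Set (σ → Bool) :=
  { q | if V A.accept then V q = true else V (Equiv.swap A.accept f q) = true }

theorem starEnc_accept (A : BFA α σ) {f : σ → Bool} (hf : A.g f = true) {X : Set (σ → Bool)}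
    (hX : (∃ r ∈ X, A.g r = true) → A.accept ∈ X) :
    A.starEnc f X A.accept = true ↔ ∃ r ∈ X, A.g r = true := by
  by_cases h : ∃ r ∈ X, A.g r = true
  · simp [starEnc, hX h, h]
  · have : f ∉ X := fun hfX => h ⟨f, hfX, hf⟩
    simp [starEnc, this, h]

theorem starDec_starEnc (A : BFA α σ) {f : σ → Bool} (hf : A.g f = true) {X : Set (σ → Bool)}
    (hX : (∃ r ∈ X, A.g r = true) → A.accept ∈ X) :
    A.starDec f (A.starEnc f X) = X := by
  ext q
  have key := A.starEnc_accept hf hX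
  by_cases h : ∃ r ∈ X, A.g r = true
  · simp only [starDec, Set.mem_ofPred_eq, if_pos (key.mpr h)]
    simp [starEnc, if_pos h]
  · simp only [starDec, Set.mem_ofPred_eq, if_neg (mt key.mp h)]
    simp only [starEnc, if_neg h, Equiv.swap_apply_self, decide_eq_true_eq]

theorem accept_mem_starStep (A : BFA α σ) (a : α) (X : Set (σ → Bool))
    (h : ∃ r ∈ A.starStep a X, A.g r = true) : A.accept ∈ A.starStep a X := by
  obtain ⟨_, ⟨r, hr, rfl⟩ | ⟨h', -⟩, hg⟩ := h
  · exact Or.inr ⟨⟨r, hr, hg⟩, rfl⟩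
  · exact Or.inr ⟨h', rfl⟩

theorem exists_mem_starStep_iff (A : BFA α σ) (a : α) (X : Set (σ → Bool)) :
    (∃ r ∈ A.starStep a X, A.g r = true) ↔ ∃ r ∈ X, A.g (fun q => A.δ q a r) = true := by
  constructor
  · rintro ⟨_, ⟨r, hr, rfl⟩ | ⟨h', -⟩, hg⟩
    · exact ⟨r, hr, hg⟩
    · exact h'
  · rintro ⟨r, hr, hg⟩
    exact ⟨_, Or.inl ⟨r, hr, rfl⟩, hg⟩

open Classical in
/-- The alternating automaton for `L∗`, where `f` satisfies the initial function of `A`. -/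
noncomputable def star (A : BFA α σ) (f : σ → Bool) : BFA α (σ → Bool) where
  δ q a V := A.starEnc f (A.starStep a (A.starDec f V)) q
  g V := V A.accept
  accept q := decide (q = A.accept)

theorem starDec_vec_star (A : BFA α σ) {f : σ → Bool} (hf : A.g f = true) (w : List α) :
    A.starDec f ((A.star f).vec w) = A.starVecs w := by
  induction w with
  | nil =>
    rw [starVecs_nil]
    ext q
    simp [starDec, star, vec]
  | cons a w ih =>
    rw [starVecs_cons, ← ih]
    exact A.starDec_starEnc hf (A.accept_mem_starStep a _)

theorem language_star (A : BFA α σ) {f : σ → Bool} (hf : A.g f = true) :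
    (A.star f).language = KStar.kstar A.language := by
  ext w
  rw [mem_language]
  cases w with
  | nil => simp [star, vec, Language.nil_mem_kstar]
  | cons a w =>
    rw [cons_mem_kstar_language, ← A.starDec_vec_star hf, ← exists_mem_starStep_iff]
    exact A.starEnc_accept hf (A.accept_mem_starStep a _)

/-- An automaton accepting only the empty word. -/
def epsilon (α : Type) {τ : Type} (q₀ : τ) : BFA α τ where
  δ _ _ _ := false
  g V := V q₀
  accept _ := true

theorem language_epsilon {τ : Type} (q₀ : τ) : (epsilon α q₀).language = 1 := by
  ext w
  rw [mem_language, Language.mem_one]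
  cases w <;> simp [epsilon, vec]

end BFA

/-- If `L` is accepted by an `n`-state BFA, then `L∗` is accepted by a
`2^n`-state AFA. -/
theorem bfa_star_upper (α : Type) [Fintype α] (L : Language α) (n : ℕ)
    (h : AcceptsBFA L n) :
    AcceptsAFA (KStar.kstar L) (2 ^ n) := by
  obtain ⟨σ, _, rfl, A, rfl⟩ := h
  classical
  refine ⟨σ → Bool, inferInstance, by simp, ?_⟩
  by_cases hf : ∃ f, A.g f = true
  · obtain ⟨f, hf⟩ := hf
    exact ⟨A.star f, ⟨A.accept, rfl⟩, A.language_star hf⟩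
  · refine ⟨BFA.epsilon α A.accept, ⟨A.accept, rfl⟩, ?_⟩
    have hA : A.language = 0 := by
      ext w
      rw [BFA.mem_language]
      exact ⟨fun h => (hf ⟨_, h⟩).elim, fun h => (Language.notMem_zero w h).elim⟩
    rw [BFA.language_epsilon, hA, kstar_zero]
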